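/- Let V be a complex vector space equipped with two seminorms |·|₁ and |·|₀, let k ≥ 0, and let ‖u‖_H = (|u|₁² + k²|u|₀²)^{1/2} be a norm on V with V finite-dimensional. Let a, ã, m, m̃, b be sesquilinear forms on V, let H > 0, q₁, q₂ ∈ ℕ, and C₁, C₂ ≥ 0 satisfy |a(u,v) − ã(u,v)| ≤ C₁ H^{q₁+1} |u|₁|v|₁ and |m(u,v) − m̃(u,v)| ≤ C₂ H^{q₂+1} |u|₀|v|₀ for all u, v ∈ V. Define 𝒜(u,v) = a(u,v) − k² m(u,v) − i k b(u,v) and 𝒜̃(u,v) = ã(u,v) − k² m̃(u,v) − i k b(u,v), and let γ denote the inf-sup constant of 𝒜 with respect to ‖·‖_H. Then the inf-sup constant γ̃ of 𝒜̃ with respect to ‖·‖_H satisfies γ̃ ≥ γ − max{C₁ H^{q₁+1}, C₂ H^{q₂+1}}. In particular, if γ > 0, then γ̃ > 0 for all sufficiently small H. -/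

import Mathlib

/-- On a finite-dimensional space every conjugate-linear functional is bounded with respect to any
definite seminorm. -/
theorem Seminorm.exists_norm_le_mul_of_definite {V : Type*} [AddCommGroup V] [Module ℂ V]
    [FiniteDimensional ℂ V] (p : Seminorm ℂ V) (hp : ∀ v, p v = 0 → v = 0) (f : V →ₗ⋆[ℂ] ℂ) :
    ∃ C : ℝ, 0 ≤ C ∧ ∀ v, ‖f v‖ ≤ C * p v := by
  let : Norm V := ⟨p⟩
  have core : NormedSpace.Core ℂ V :=
    { norm_nonneg := fun v => apply_nonneg p v
      norm_smul := fun c v => map_smul_eq_mul p c v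
      norm_triangle := fun v w => map_add_le_add p v w
      norm_eq_zero_iff := fun v => ⟨hp v, fun h => by rw [h]; exact map_zero p⟩ }
  let : NormedAddCommGroup V := NormedAddCommGroup.ofCore core
  let : NormedSpace ℂ V := NormedSpace.ofCore core
  let g : V →ₗ[ℂ] ℂ :=
    { toFun := fun v => star (f v)
      map_add' := fun v w => by simp
      map_smul' := fun c v => by simp }
  refine ⟨‖g.toContinuousLinearMap‖, norm_nonneg _, fun v => ?_⟩
  have h := g.toContinuousLinearMap.le_opNorm v
  have e : ‖g.toContinuousLinearMap v‖ = ‖f v‖ := norm_star (f v)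
  rwa [e] at h

/-- If a nonnegative kernel `F` exceeds a kernel `G` by at most `δ` pointwise and the rows of `G` are
bounded above, then the inf-sup value of `F` exceeds that of `G` by at most `δ`. -/
theorem iInf_iSup_sub_le_iInf_iSup {ι : Type*} {F G : ι → ι → ℝ} {δ : ℝ} (hδ : 0 ≤ δ)
    (hF : ∀ i j, 0 ≤ F i j) (hG : ∀ i, BddAbove (Set.range (G i)))
    (hFG : ∀ i j, F i j ≤ G i j + δ) :
    (⨅ i, ⨆ j, F i j) - δ ≤ ⨅ i, ⨆ j, G i j := by
  rcases isEmpty_or_nonempty ι with hι | hι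
  · simpa [Real.iInf_of_isEmpty] using hδ
  · refine le_ciInf fun i => ?_
    have h1 : (⨅ i, ⨆ j, F i j) ≤ ⨆ j, F i j :=
      ciInf_le ⟨0, Set.forall_mem_range.2 fun i => Real.iSup_nonneg (hF i)⟩ i
    have h2 : (⨆ j, F i j) ≤ (⨆ j, G i j) + δ :=
      ciSup_le fun j => (hFG i j).trans (by gcongr; exact le_ciSup (hG i) j)
    linarith

/-- The Cauchy–Schwarz inequality in `ℝ²` with weights `1` and `k ^ 2`. -/
theorem Real.mul_add_sq_mul_le_sqrt_mul_sqrt (x y z w k : ℝ) :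
    x * z + k ^ 2 * (y * w) ≤ √(x ^ 2 + k ^ 2 * y ^ 2) * √(z ^ 2 + k ^ 2 * w ^ 2) := by
  rw [← Real.sqrt_mul (by positivity)]
  apply Real.le_sqrt_of_sq_le
  nlinarith [sq_nonneg (k * (x * w - y * z))]


/-- **Discrete stability of the surrogate Helmholtz form.**
Let `V` be a finite-dimensional complex vector space with two seminorms
`n₁, n₀`, let `k ≥ 0`, and suppose `‖u‖_H = √(n₁(u)² + k²·n₀(u)²)` is a norm
(positive definite). Let `a, ã, m, m̃, b` be sesquilinear forms with
`|a(u,v) − ã(u,v)| ≤ C₁H^{q₁+1} n₁(u)n₁(v)` and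
`|m(u,v) − m̃(u,v)| ≤ C₂H^{q₂+1} n₀(u)n₀(v)`. With
`𝒜(u,v) = a(u,v) − k²m(u,v) − ik·b(u,v)` and the analogous surrogate `𝒜̃`,
the inf-sup constant of `𝒜̃` with respect to `‖·‖_H` is at least that of `𝒜`
minus `max{C₁H^{q₁+1}, C₂H^{q₂+1}}`; in particular it is positive once the
latter quantity drops below the inf-sup constant of `𝒜` (i.e. for all
sufficiently small `H`). -/
theorem surrogate_helmholtz_infsup_stability
    {V : Type*} [AddCommGroup V] [Module ℂ V] [FiniteDimensional ℂ V]
    (n1 n0 : Seminorm ℂ V) (k : ℝ) (hk : 0 ≤ k)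
    (normH : V → ℝ)
    (hnormH : ∀ u : V, normH u = Real.sqrt ((n1 u) ^ 2 + k ^ 2 * (n0 u) ^ 2))
    (hdef : ∀ u : V, normH u = 0 → u = 0)
    (a ta m tm b : V →ₗ[ℂ] V →ₗ⋆[ℂ] ℂ)
    (H : ℝ) (hH : 0 < H) (q1 q2 : ℕ)
    (C1 C2 : ℝ) (hC1 : 0 ≤ C1) (hC2 : 0 ≤ C2)
    (ha : ∀ u v : V, ‖a u v - ta u v‖ ≤ C1 * H ^ (q1 + 1) * n1 u * n1 v)
    (hm : ∀ u v : V, ‖m u v - tm u v‖ ≤ C2 * H ^ (q2 + 1) * n0 u * n0 v)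
    (𝒜 𝒜' : V → V → ℂ)
    (h𝒜 : ∀ u v : V, 𝒜 u v =
      a u v - (k : ℂ) ^ 2 * m u v - Complex.I * (k : ℂ) * b u v)
    (h𝒜' : ∀ u v : V, 𝒜' u v =
      ta u v - (k : ℂ) ^ 2 * tm u v - Complex.I * (k : ℂ) * b u v) :
    (⨅ u : {u : V // u ≠ 0}, ⨆ v : {v : V // v ≠ 0},
        ‖𝒜' (u : V) (v : V)‖ / (normH (u : V) * normH (v : V))) ≥
      (⨅ u : {u : V // u ≠ 0}, ⨆ v : {v : V // v ≠ 0},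
        ‖𝒜 (u : V) (v : V)‖ / (normH (u : V) * normH (v : V))) -
        max (C1 * H ^ (q1 + 1)) (C2 * H ^ (q2 + 1)) ∧
    ((0 < ⨅ u : {u : V // u ≠ 0}, ⨆ v : {v : V // v ≠ 0},
        ‖𝒜 (u : V) (v : V)‖ / (normH (u : V) * normH (v : V))) →
      max (C1 * H ^ (q1 + 1)) (C2 * H ^ (q2 + 1)) <
        (⨅ u : {u : V // u ≠ 0}, ⨆ v : {v : V // v ≠ 0},
          ‖𝒜 (u : V) (v : V)‖ / (normH (u : V) * normH (v : V))) →
      0 < ⨅ u : {u : V // u ≠ 0}, ⨆ v : {v : V // v ≠ 0},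
        ‖𝒜' (u : V) (v : V)‖ / (normH (u : V) * normH (v : V))) := by
  set δ := max (C1 * H ^ (q1 + 1)) (C2 * H ^ (q2 + 1)) with hδ_def
  have hδ : 0 ≤ δ := le_max_of_le_left (by positivity)
  have hpos : ∀ u : {u : V // u ≠ 0}, 0 < normH u := fun u =>
    lt_of_le_of_ne (by rw [hnormH]; positivity) fun h => u.2 (hdef u h.symm)
  have hp_apply : ∀ v, (n1 + k.toNNReal • n0) v = n1 v + k * n0 v := fun v => by
    simp [NNReal.smul_def, hk]
  have hp_le : ∀ v, (n1 + k.toNNReal • n0) v ≤ 2 * normH v := fun v => by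
    have h1 : n1 v ≤ normH v := by
      rw [hnormH]
      exact Real.le_sqrt_of_sq_le (le_add_of_nonneg_right (by positivity))
    have h0 : k * n0 v ≤ normH v := by
      rw [hnormH]
      exact Real.le_sqrt_of_sq_le (by rw [mul_pow]; exact le_add_of_nonneg_left (by positivity))
    rw [hp_apply]
    linarith
  have hp_def : ∀ v, (n1 + k.toNNReal • n0) v = 0 → v = 0 := fun v hv => by
    rw [hp_apply] at hv
    have h0 : 0 ≤ k * n0 v := by positivity
    have h1 : 0 ≤ n1 v := by positivity
    have e1 : n1 v = 0 := by linarith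
    have e0 : k * n0 v = 0 := by linarith
    apply hdef
    rw [hnormH, ← mul_pow, e1, e0]
    simp
  have hbdd : ∀ u : {u : V // u ≠ 0}, BddAbove (Set.range fun v : {v : V // v ≠ 0} =>
      ‖𝒜' (u : V) (v : V)‖ / (normH (u : V) * normH (v : V))) := fun u => by
    obtain ⟨C, hC, hf⟩ := (n1 + k.toNNReal • n0).exists_norm_le_mul_of_definite hp_def
      (ta u - (k : ℂ) ^ 2 • tm u - (Complex.I * (k : ℂ)) • b u)
    refine ⟨2 * C / normH u, Set.forall_mem_range.2 fun v => ?_⟩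
    have hu := hpos u
    have hv := hpos v
    rw [div_le_div_iff₀ (mul_pos hu hv) hu]
    have h : ‖𝒜' u v‖ ≤ C * (2 * normH v) := by
      rw [h𝒜']
      exact (hf v).trans (by gcongr; exact hp_le v)
    calc ‖𝒜' u v‖ * normH u ≤ C * (2 * normH v) * normH u := by gcongr
      _ = 2 * C * (normH u * normH v) := by ring
  have hpert : ∀ u v, ‖𝒜 u v - 𝒜' u v‖ ≤ δ * (normH u * normH v) := fun u v => by
    have e : 𝒜 u v - 𝒜' u v = (a u v - ta u v) - (k : ℂ) ^ 2 * (m u v - tm u v) := by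
      rw [h𝒜, h𝒜']
      ring
    have hk2 : ‖(k : ℂ) ^ 2‖ = k ^ 2 := by simp
    calc ‖𝒜 u v - 𝒜' u v‖ ≤ ‖a u v - ta u v‖ + k ^ 2 * ‖m u v - tm u v‖ := by
          rw [e, ← hk2, ← norm_mul]
          exact norm_sub_le _ _
      _ ≤ δ * n1 u * n1 v + k ^ 2 * (δ * n0 u * n0 v) := by
          gcongr
          · exact (ha u v).trans (by gcongr; exact le_max_left _ _)
          · exact (hm u v).trans (by gcongr; exact le_max_right _ _)
      _ = δ * (n1 u * n1 v + k ^ 2 * (n0 u * n0 v)) := by ring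
      _ ≤ δ * (normH u * normH v) := by
          rw [hnormH u, hnormH v]
          gcongr
          exact Real.mul_add_sq_mul_le_sqrt_mul_sqrt _ _ _ _ _
  have key := iInf_iSup_sub_le_iInf_iSup
    (F := fun u v : {v : V // v ≠ 0} => ‖𝒜 u v‖ / (normH u * normH v))
    (G := fun u v : {v : V // v ≠ 0} => ‖𝒜' u v‖ / (normH u * normH v)) hδ
    (fun u v => div_nonneg (norm_nonneg _) (mul_pos (hpos u) (hpos v)).le) hbdd
    (fun u v => by
      have huv := mul_pos (hpos u) (hpos v)
      rw [div_add' _ _ _ huv.ne']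
      gcongr
      linarith [hpert u v, norm_sub_norm_le (𝒜 u v) (𝒜' u v)])
  exact ⟨key, fun _ h => (sub_pos.2 h).trans_le key⟩
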